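/- arXiv:2402.11918 — 2 statements merged into one kernel-verified Lean document; each statement's English description precedes it below -/
import Mathlib

section
/- The set S_∅ of critical hospitals is feasible, i.e., S_∅ ∈ F_H; more precisely, the matching μ_∅ is itself a super-stable matching in the induced subgraph G⟨V \ S_∅⟩. -/
open Set

/-- `incid v e` : edge `e` is incident to vertex `v`. -/
def incid {V : Type*} (v : V) (e : V × V) : Prop := e.1 = v ∨ e.2 = v

/-- An instance of the super-stable matching problem with ties: a finite simple
bipartite graph whose vertices are partitioned into doctors `Dset` and
hospitals `Hset`, each edge `(d,h)` joining a doctor to a hospital, together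
with, for each vertex `v`, a transitive and total preference relation
`pref v` (possibly with ties) on the edges incident to `v`. -/
structure SMInstance (V : Type*) where
  Dset : Set V
  Hset : Set V
  E : Set (V × V)
  pref : V → (V × V) → (V × V) → Prop
  disj : Disjoint Dset Hset
  cover : Dset ∪ Hset = Set.univ
  edge_mem : ∀ e ∈ E, e.1 ∈ Dset ∧ e.2 ∈ Hset
  pref_total : ∀ v, ∀ e ∈ E, ∀ f ∈ E, incid v e → incid v f →
    pref v e f ∨ pref v f e
  pref_trans : ∀ v, ∀ e ∈ E, ∀ f ∈ E, ∀ g ∈ E,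
    incid v e → incid v f → incid v g →
    pref v e f → pref v f g → pref v e g

namespace SMInstance

variable {V : Type*} (I : SMInstance V)

/-- Strict preference `e ≻_v f`. -/
def sprefer (v : V) (e f : V × V) : Prop := I.pref v e f ∧ ¬ I.pref v f e

/-- `Ch_d(F)` for a doctor `d`. -/
def Chd (d : V) (F : Set (V × V)) : Set (V × V) :=
  {e ∈ F | incid d e ∧ ∀ f ∈ F, incid d f → I.pref d e f}

/-- `Ch_h(F)` for a hospital `h`. -/
def Chh (h : V) (F : Set (V × V)) : Set (V × V) :=
  {e ∈ F | incid h e ∧ ∀ f ∈ F, incid h f → f ≠ e → I.sprefer h e f}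

/-- `Ch_D(F) = ⋃_{d ∈ D} Ch_d(F)`. -/
def ChD (F : Set (V × V)) : Set (V × V) := ⋃ d ∈ I.Dset, I.Chd d F

/-- `Ch_H(F) = ⋃_{h ∈ H} Ch_h(F)`. -/
def ChH (F : Set (V × V)) : Set (V × V) := ⋃ h ∈ I.Hset, I.Chh h F

/-- `D[F]` : the set of doctors incident to some edge of `F`. -/
def docs (F : Set (V × V)) : Set V := {d ∈ I.Dset | ∃ e ∈ F, incid d e}

/-- The sequence `R_{X,t}` of the preprocessing algorithm:
`R_{X,0} = E(X)`, and `R_{X,t+1} = R_{X,t} ∪ (P_{X,t+1} \ Q_{X,t+1})` where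
`P_{X,t+1} = Ch_D(E \ R_{X,t})` and
`Q_{X,t+1} = Ch_H(P_{X,t+1} ∪ R_{X,t}) ∩ P_{X,t+1}`. -/
def R (X : Set V) : ℕ → Set (V × V)
  | 0 => {e ∈ I.E | e.2 ∈ X}
  | t + 1 =>
      R X t ∪
        (I.ChD (I.E \ R X t) \
          (I.ChH (I.ChD (I.E \ R X t) ∪ R X t) ∩ I.ChD (I.E \ R X t)))

/-- `k_X` : the least `t ≥ 1` with `R_{X,t} = R_{X,t-1}`. -/
noncomputable def kX (X : Set V) : ℕ :=
  sInf {t : ℕ | 1 ≤ t ∧ I.R X t = I.R X (t - 1)}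

/-- `B_X = R_{X,k_X}`. -/
noncomputable def B (X : Set V) : Set (V × V) := I.R X (I.kX X)

/-- A matching in the induced subgraph `G⟨V \ X⟩`. -/
def isMatching (X : Set V) (μ : Set (V × V)) : Prop :=
  μ ⊆ I.E ∧ (∀ e ∈ μ, e.1 ∉ X ∧ e.2 ∉ X) ∧
    ∀ v, ∀ e ∈ μ, ∀ f ∈ μ, incid v e → incid v f → e = f

/-- `e = (d,h)` blocks the matching `μ` of `G⟨V \ X⟩`:
`e ∈ E⟨V \ X⟩ \ μ`, `e ≿_d μ(d)` and `e ≿_h μ(h)`. -/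
def blocks (X : Set V) (μ : Set (V × V)) (e : V × V) : Prop :=
  e ∈ I.E ∧ e.1 ∉ X ∧ e.2 ∉ X ∧ e ∉ μ ∧
    (∀ f ∈ μ, incid e.1 f → I.pref e.1 e f) ∧
    (∀ f ∈ μ, incid e.2 f → I.pref e.2 e f)

/-- `μ` is a super-stable matching in `G⟨V \ X⟩`. -/
def superStable (X : Set V) (μ : Set (V × V)) : Prop :=
  I.isMatching X μ ∧ ∀ e, ¬ I.blocks X μ e

/-- `X` is feasible: `G⟨V \ X⟩` admits a super-stable matching. -/
def feasible (X : Set V) : Prop := ∃ μ, I.superStable X μ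

/-- `h` is a critical hospital with respect to `(B_X, μ_X)`:
`μ_X(h) = ∅` and at least one of `B_X(h) ≠ ∅` and
`Ch_D(E \ B_X) ∩ E(h) ≠ ∅` holds. -/
def critical (X : Set V) (μ : Set (V × V)) (h : V) : Prop :=
  h ∈ I.Hset ∧ (∀ e ∈ μ, ¬ incid h e) ∧
    ((∃ e ∈ I.B X, incid h e) ∨ ∃ e ∈ I.ChD (I.E \ I.B X), incid h e)

end SMInstance

namespace SMInstance

variable {V : Type*} (I : SMInstance V)

theorem R_mono (X : Set V) : Monotone (I.R X) :=
  monotone_nat_of_le_succ fun _ => subset_union_left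

theorem kX_spec [Finite V] (X : Set V) :
    1 ≤ I.kX X ∧ I.R X (I.kX X) = I.R X (I.kX X - 1) := by
  refine Nat.sInf_mem (s := {t : ℕ | 1 ≤ t ∧ I.R X t = I.R X (t - 1)}) ?_
  obtain ⟨n, hn⟩ := WellFoundedGT.monotone_chain_condition ⟨I.R X, I.R_mono X⟩
  exact ⟨n + 1, by omega, (hn (n + 1) (by omega)).symm⟩

/-- When the preprocessing stops, no proposed edge is rejected. -/
theorem ChD_compl_B_subset_ChH [Finite V] (X : Set V) :
    I.ChD (I.E \ I.B X) ⊆ I.ChH (I.ChD (I.E \ I.B X) ∪ I.B X) := by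
  obtain ⟨hk, hR⟩ := I.kX_spec X
  obtain ⟨t, ht⟩ : ∃ t, I.kX X = t + 1 := ⟨I.kX X - 1, by omega⟩
  have hB : I.B X = I.R X t := by rw [B, hR, ht, Nat.add_sub_cancel]
  have hB' : I.B X = I.R X (t + 1) := by rw [B, ht]
  intro p hp
  by_contra hpQ
  have hpE : p ∈ I.E \ I.B X := by
    simp only [ChD, mem_iUnion] at hp
    obtain ⟨d, -, hd⟩ := hp
    exact hd.1
  refine hpE.2 ?_
  rw [hB']
  rw [hB] at hp hpQ
  exact Or.inr ⟨hp, fun h => hpQ h.1⟩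

/-- A proposed edge is strictly preferred by its hospital to every other
proposed or rejected edge at that hospital. -/
theorem sprefer_of_mem_ChD [Finite V] {X : Set V} {h : V} (hh : h ∈ I.Hset)
    {e f : V × V} (hf : f ∈ I.ChD (I.E \ I.B X)) (hfE : f ∈ I.E) (hfh : incid h f)
    (he : e ∈ I.ChD (I.E \ I.B X) ∪ I.B X) (heh : incid h e) (hne : e ≠ f) :
    I.sprefer h f e := by
  have hd := I.disj.notMem_of_mem_left
  obtain ⟨hf1, hf2⟩ := I.edge_mem f hfE
  have hfQ := I.ChD_compl_B_subset_ChH X hf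
  simp only [ChH, mem_iUnion] at hfQ
  obtain ⟨h', hh', -, hinc, hpref⟩ := hfQ
  have hospital_eq : ∀ k ∈ I.Hset, incid k f → f.2 = k := by
    rintro k hk (rfl | rfl)
    · exact absurd hk (hd hf1)
    · rfl
  obtain rfl := hospital_eq h hh hfh
  obtain rfl := hospital_eq h' hh' hinc
  exact hpref e he heh hne

/-- An edge that its doctor weakly prefers to an edge chosen from `F` is itself
chosen from `F`. -/
theorem mem_ChD_of_pref {F : Set (V × V)} (hF : F ⊆ I.E) {e f : V × V}
    (he : e ∈ F) (hf : f ∈ I.ChD F) (hef : incid e.1 f) (hp : I.pref e.1 e f) :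
    e ∈ I.ChD F := by
  have hd := I.disj.notMem_of_mem_left
  simp only [ChD, mem_iUnion] at hf ⊢
  obtain ⟨d, hdD, hfF, hinc, hpref⟩ := hf
  obtain ⟨he1, -⟩ := I.edge_mem e (hF he)
  obtain ⟨-, hf2⟩ := I.edge_mem f (hF hfF)
  have doctor_eq : ∀ k ∈ I.Dset, incid k f → f.1 = k := by
    rintro k hk (rfl | rfl)
    · rfl
    · exact absurd hf2 (hd hk)
  have hde : d = e.1 := (doctor_eq d hdD hinc).symm.trans (doctor_eq e.1 he1 hef)
  subst hde
  exact ⟨e.1, he1, he, Or.inl rfl, fun g hg hgi =>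
    I.pref_trans e.1 e (hF he) f (hF hfF) g (hF hg) (Or.inl rfl) hef hgi hp
      (hpref g hg hgi)⟩

end SMInstance

/-- The set `S_∅` of critical hospitals is feasible, i.e. `S_∅ ∈ F_H`;
more precisely, `μ_∅` is itself a super-stable matching in
`G⟨V \ S_∅⟩`. -/
theorem statement7 {V : Type*} [Fintype V] (I : SMInstance V)
    (μ0 : Set (V × V)) (hμ0 : I.isMatching (∅ : Set V) μ0)
    (hμ0Ch : μ0 ⊆ I.ChD (I.E \ I.B (∅ : Set V)))
    (hμ0cov : ∀ d ∈ I.docs (I.E \ I.B (∅ : Set V)), ∃ e ∈ μ0, incid d e) :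
    {h | I.critical (∅ : Set V) μ0 h} ⊆ I.Hset ∧
    I.superStable {h | I.critical (∅ : Set V) μ0 h} μ0 ∧
    I.feasible {h | I.critical (∅ : Set V) μ0 h} := by
  have hsub : {h | I.critical (∅ : Set V) μ0 h} ⊆ I.Hset := fun h hh => hh.1
  have hstable : I.superStable {h | I.critical (∅ : Set V) μ0 h} μ0 := by
    refine ⟨⟨hμ0.1, fun e he => ⟨fun hc => hc.2.1 e he (Or.inl rfl),
      fun hc => hc.2.1 e he (Or.inr rfl)⟩, hμ0.2.2⟩, ?_⟩
    rintro e ⟨heE, -, hcrit, heμ, hdoc, hhosp⟩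
    obtain ⟨he1, he2⟩ := I.edge_mem e heE
    have hmem : e ∈ I.ChD (I.E \ I.B ∅) ∪ I.B ∅ := by
      by_cases heB : e ∈ I.B ∅
      · exact Or.inr heB
      · obtain ⟨f, hf, hef⟩ := hμ0cov e.1 ⟨he1, e, ⟨heE, heB⟩, Or.inl rfl⟩
        exact Or.inl (I.mem_ChD_of_pref sdiff_subset ⟨heE, heB⟩ (hμ0Ch hf) hef
          (hdoc f hf hef))
    obtain ⟨g, hg, hgi⟩ : ∃ g ∈ μ0, incid e.2 g := by
      by_contra! hno
      exact hcrit ⟨he2, hno, hmem.symm.imp (fun h => ⟨e, h, Or.inr rfl⟩)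
        fun h => ⟨e, h, Or.inr rfl⟩⟩
    exact (I.sprefer_of_mem_ChD he2 (hμ0Ch hg) (hμ0.1 hg) hgi hmem (Or.inr rfl)
      fun h => heμ (h ▸ hg)).2 (hhosp g hg hgi)
  exact ⟨hsub, hstable, μ0, hstable⟩
end

section
/- Let X ∈ F_H and let σ be a super-stable matching in G⟨V \ X⟩. Then |μ_∅| ≥ |σ|. -/
open Set

namespace SMInstance

variable {V : Type*} (I : SMInstance V)

lemma fst_eq_of_incid {d : V} {e : V × V} (hd : d ∈ I.Dset) (he : e ∈ I.E)
    (h : incid d e) : e.1 = d := by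
  rcases h with h | h
  · exact h
  · exact absurd (h ▸ (I.edge_mem e he).2) (Set.disjoint_left.mp I.disj hd)

/-- An edge selected by its doctor from `F ⊆ E` is weakly preferred by that doctor to every
edge of `F` at the same doctor. -/
lemma mem_ChD_imp {F : Set (V × V)} (hF : F ⊆ I.E) {f : V × V} (hf : f ∈ I.ChD F) :
    f ∈ F ∧ ∀ g ∈ F, incid f.1 g → I.pref f.1 f g := by
  simp only [ChD, Set.mem_iUnion] at hf
  obtain ⟨d, hd, hfF, hdf, hmax⟩ := hf
  obtain rfl := I.fst_eq_of_incid hd (hF hfF) hdf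
  exact ⟨hfF, hmax⟩

/-- A set of edges disjoint from `R_{∅,t}` offers no doctor anything strictly better than an edge
already rejected. -/
lemma pref_of_mem_R_empty {t : ℕ} {σ : Set (V × V)} (hσE : σ ⊆ I.E)
    (hdisj : Disjoint σ (I.R ∅ t)) {f : V × V} (hf : f ∈ I.R ∅ t) :
    f ∈ I.E ∧ ∀ g ∈ σ, incid f.1 g → I.pref f.1 f g := by
  induction t with
  | zero => simp [R] at hf
  | succ t ih =>
    have hd : Disjoint σ (I.R ∅ t) := hdisj.mono_right Set.subset_union_left
    rcases hf with hf | ⟨hf, -⟩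
    · exact ih hd hf
    · obtain ⟨hfE, hmax⟩ := I.mem_ChD_imp Set.sdiff_subset hf
      exact ⟨hfE.1, fun g hg => hmax g ⟨hσE hg, Set.disjoint_left.mp hd hg⟩⟩

/-- A super-stable matching avoiding a set of hospitals contains no edge rejected by the
preprocessing started from `∅`. -/
lemma superStable.disjoint_R_empty {X : Set V} (hX : X ⊆ I.Hset) {σ : Set (V × V)}
    (hσ : I.superStable X σ) (t : ℕ) : Disjoint σ (I.R ∅ t) := by
  obtain ⟨⟨hσE, hσX, hσu⟩, hstable⟩ := hσ
  induction t with
  | zero => simp [R]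
  | succ t ih =>
    rw [Set.disjoint_left]
    rintro e heσ (heR | ⟨heP, heQ⟩)
    · exact Set.disjoint_left.mp ih heσ heR
    have hbest : ∀ f ∈ I.ChD (I.E \ I.R ∅ t) ∪ I.R ∅ t,
        f ∈ I.E ∧ ∀ g ∈ σ, incid f.1 g → I.pref f.1 f g := by
      rintro f (hf | hf)
      · obtain ⟨hfE, hmax⟩ := I.mem_ChD_imp Set.sdiff_subset hf
        exact ⟨hfE.1, fun g hg => hmax g ⟨hσE hg, Set.disjoint_left.mp ih hg⟩⟩
      · exact I.pref_of_mem_R_empty hσE ih hf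
    apply heQ
    refine ⟨?_, heP⟩
    simp only [ChH, Set.mem_iUnion]
    refine ⟨e.2, (I.edge_mem e (hσE heσ)).2, Or.inl heP, Or.inr rfl, fun f hf hef hne => ?_⟩
    obtain ⟨hfE, hfσ⟩ := hbest f hf
    have hf2 : f.2 = e.2 := by
      rcases hef with h | h
      · exact absurd (I.edge_mem e (hσE heσ)).2
          (Set.disjoint_left.mp I.disj (h ▸ (I.edge_mem f hfE).1))
      · exact h
    have hnot : ¬ I.pref e.2 f e := by
      intro hfe
      refine hstable f ⟨hfE, ?_, hf2 ▸ (hσX e heσ).2, ?_, hfσ, ?_⟩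
      · exact fun h => Set.disjoint_left.mp I.disj (I.edge_mem f hfE).1 (hX h)
      · exact fun h => hne (hσu e.2 f h e heσ (Or.inr hf2) (Or.inr rfl))
      · intro g hg hfg
        rw [hf2] at hfg ⊢
        rwa [hσu e.2 g hg e heσ hfg (Or.inr rfl)]
    exact ⟨(I.pref_total e.2 e (hσE heσ) f hfE (Or.inr rfl) hef).resolve_right hnot, hnot⟩

end SMInstance

/-- Let `X ∈ F_H` and let `σ` be a super-stable matching in `G⟨V \ X⟩`.
Then `|μ_∅| ≥ |σ|`. -/
theorem statement8 {V : Type*} [Fintype V] (I : SMInstance V)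
    (μ0 : Set (V × V)) (hμ0 : I.isMatching (∅ : Set V) μ0)
    (hμ0Ch : μ0 ⊆ I.ChD (I.E \ I.B (∅ : Set V)))
    (hμ0cov : ∀ d ∈ I.docs (I.E \ I.B (∅ : Set V)), ∃ e ∈ μ0, incid d e)
    (X : Set V) (hX : X ⊆ I.Hset)
    (σ : Set (V × V)) (hσ : I.superStable X σ) :
    σ.ncard ≤ μ0.ncard := by
  have hdisj : Disjoint σ (I.B ∅) := SMInstance.superStable.disjoint_R_empty I hX hσ _
  obtain ⟨⟨hσE, -, hσu⟩, -⟩ := hσ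
  have hcov : ∀ e ∈ σ, ∃ m ∈ μ0, m.1 = e.1 := by
    intro e he
    have hd := (I.edge_mem e (hσE he)).1
    obtain ⟨m, hm, hem⟩ :=
      hμ0cov e.1 ⟨hd, e, ⟨hσE he, Set.disjoint_left.mp hdisj he⟩, Or.inl rfl⟩
    exact ⟨m, hm, I.fst_eq_of_incid hd (hμ0.1 hm) hem⟩
  calc σ.ncard = (Prod.fst '' σ).ncard := by
        refine (Set.InjOn.ncard_image fun e he f hf h => ?_).symm
        exact hσu e.1 e he f hf (Or.inl rfl) (Or.inl h.symm)
    _ ≤ (Prod.fst '' μ0).ncard := by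
        refine Set.ncard_le_ncard ?_ (Set.toFinite _)
        rintro _ ⟨e, he, rfl⟩
        exact hcov e he
    _ ≤ μ0.ncard := Set.ncard_image_le (Set.toFinite _)
end
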